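/- A closed subset X of M is ζ-heavy if and only if ζ(H) = 0 for every H ∈ C(M) with H ≤ 0 and H ≡ 0 on X; and X is ζ-superheavy if and only if ζ(H) = 0 for every H ∈ C(M) with H ≥ 0 and H ≡ 0 on X. -/

import Mathlib

/-- Characterizations of heaviness and superheaviness via vanishing of ζ. -/
theorem stmt_8 {M : Type*} [TopologicalSpace M] [CompactSpace M] [NormalSpace M] [Nonempty M]
    (ζ : C(M, ℝ) → ℝ)
    (hnorm : ∀ c : ℝ, ζ (ContinuousMap.const M c) = c)
    (hstab : ∀ H₁ H₂ : C(M, ℝ),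
      (⨅ x, (H₁ x - H₂ x)) ≤ ζ H₁ - ζ H₂ ∧ ζ H₁ - ζ H₂ ≤ ⨆ x, (H₁ x - H₂ x))
    (hhom : ∀ s : ℝ, 0 < s → ∀ H : C(M, ℝ), ζ (s • H) = s * ζ H)
    (X : Set M) (hX : IsClosed X) (hXne : X.Nonempty) :
    ((∀ H : C(M, ℝ), sInf (H '' X) ≤ ζ H) ↔
      (∀ H : C(M, ℝ), (∀ x, H x ≤ 0) → (∀ x ∈ X, H x = 0) → ζ H = 0)) ∧
    ((∀ H : C(M, ℝ), ζ H ≤ sSup (H '' X)) ↔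
      (∀ H : C(M, ℝ), (∀ x, 0 ≤ H x) → (∀ x ∈ X, H x = 0) → ζ H = 0)) := by
  have hzero : ζ 0 = 0 := hnorm 0
  have hbdd (H : C(M, ℝ)) : BddBelow (H '' X) ∧ BddAbove (H '' X) :=
    ⟨(isCompact_range H.continuous).bddBelow.mono (Set.image_subset_range _ _),
      (isCompact_range H.continuous).bddAbove.mono (Set.image_subset_range _ _)⟩
  have himage {H : C(M, ℝ)} (hH : ∀ x ∈ X, H x = 0) : H '' X = {0} :=
    (Set.image_congr hH).trans (hXne.image_const 0)
  refine ⟨⟨fun h H hle hH => ?_, fun h H => ?_⟩, ⟨fun h H hge hH => ?_, fun h H => ?_⟩⟩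
  · have hlower := h H
    rw [himage hH, csInf_singleton] at hlower
    have hupper : ζ H - ζ 0 ≤ 0 :=
      (hstab H 0).2.trans (ciSup_le fun x => by simpa using hle x)
    linarith
  · set c := sInf (H '' X)
    set K : C(M, ℝ) := H ⊓ ContinuousMap.const M c - ContinuousMap.const M c
    have hKx (x : M) : K x = min (H x) c - c := rfl
    have hK : ζ K = 0 := by
      refine h K (fun x => ?_) (fun x hx => ?_)
      · rw [hKx]
        linarith [min_le_right (H x) c]
      · rw [hKx, min_eq_right (csInf_le (hbdd H).1 (Set.mem_image_of_mem H hx)), sub_self]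
    have hle : c ≤ ζ H - ζ K :=
      (le_ciInf fun x => by rw [hKx]; linarith [min_le_left (H x) c]).trans (hstab H K).1
    linarith
  · have hupper := h H
    rw [himage hH, csSup_singleton] at hupper
    have hlower : 0 ≤ ζ H - ζ 0 :=
      (le_ciInf fun x => by simpa using hge x).trans (hstab H 0).1
    linarith
  · set c := sSup (H '' X)
    set K : C(M, ℝ) := H ⊔ ContinuousMap.const M c - ContinuousMap.const M c
    have hKx (x : M) : K x = max (H x) c - c := rfl
    have hK : ζ K = 0 := by
      refine h K (fun x => ?_) (fun x hx => ?_)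
      · rw [hKx]
        linarith [le_max_right (H x) c]
      · rw [hKx, max_eq_right (le_csSup (hbdd H).2 (Set.mem_image_of_mem H hx)), sub_self]
    have hle : ζ H - ζ K ≤ c :=
      (hstab H K).2.trans (ciSup_le fun x => by rw [hKx]; linarith [le_max_left (H x) c])
    linarith
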